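/- For all natural numbers d ≥ 1 and q, the number of aperiodic functions f : ZMod d → Fin q (meaning that for every k ∈ ZMod d with k ≠ 0 the function x ↦ f(x + k) is not equal to f) equals ∑_{j | d} μ(j) · q^{d/j}, as integers, where the sum runs over the positive divisors j of d. -/

import Mathlib

open ArithmeticFunction

/-- `f : ZMod d → Fin q` is aperiodic if no nontrivial rotation fixes it. -/
def Aperiodic (d q : ℕ) (f : ZMod d → Fin q) : Prop :=
  ∀ k : ZMod d, k ≠ 0 → (fun x => f (x + k)) ≠ f

/-- Rotation of a function on `ZMod d` by one step. -/
def rotateOne {α : Type*} (d : ℕ) (f : ZMod d → α) : ZMod d → α :=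
  fun x => f (x + 1)

theorem rotateOne_iterate {α : Type*} (d n : ℕ) (f : ZMod d → α) :
    (rotateOne d)^[n] f = fun x => f (x + n) := by
  induction n with
  | zero => simp
  | succ n ih =>
    rw [Function.iterate_succ_apply', ih]
    funext x
    simp only [rotateOne, Nat.cast_add, Nat.cast_one]
    congr 1
    ring

theorem isPeriodicPt_rotateOne_iff {α : Type*} (d n : ℕ) (f : ZMod d → α) :
    Function.IsPeriodicPt (rotateOne d) n f ↔ ∀ x, f (x + n) = f x := by
  rw [Function.IsPeriodicPt, Function.IsFixedPt, rotateOne_iterate, funext_iff]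

theorem minimalPeriod_rotateOne_dvd {α : Type*} (d : ℕ) (f : ZMod d → α) :
    Function.minimalPeriod (rotateOne d) f ∣ d :=
  Function.IsPeriodicPt.minimalPeriod_dvd ((isPeriodicPt_rotateOne_iff d d f).2 (by simp))

theorem aperiodic_iff_minimalPeriod_eq {d q : ℕ} (hd : 1 ≤ d) (f : ZMod d → Fin q) :
    Aperiodic d q f ↔ Function.minimalPeriod (rotateOne d) f = d := by
  have : NeZero d := ⟨by omega⟩
  constructor
  · intro h
    by_contra hne
    refine h (Function.minimalPeriod (rotateOne d) f : ℕ) ?_ (funext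
      ((isPeriodicPt_rotateOne_iff d _ f).1 (Function.isPeriodicPt_minimalPeriod _ _)))
    rw [Ne, ZMod.natCast_eq_zero_iff]
    exact fun h' => hne (Nat.dvd_antisymm (minimalPeriod_rotateOne_dvd d f) h')
  · intro h k hk hf
    apply hk
    have hper : Function.IsPeriodicPt (rotateOne d) k.val f := by
      rw [isPeriodicPt_rotateOne_iff, ZMod.natCast_zmod_val]
      exact fun x => congrFun hf x
    have hdvd := hper.minimalPeriod_dvd
    rwa [h, ← ZMod.natCast_eq_zero_iff, ZMod.natCast_zmod_val] at hdvd

/-- The functions on `ZMod d` with period `m ∣ d` are the pullbacks of those on `ZMod m`. -/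
theorem card_isPeriodicPt_rotateOne {α : Type*} {d m : ℕ} (hd : 1 ≤ d) (hm : m ∣ d) :
    Nat.card {f : ZMod d → α // Function.IsPeriodicPt (rotateOne d) m f} = Nat.card α ^ m := by
  have : NeZero d := ⟨by omega⟩
  have : NeZero m := ⟨by rintro rfl; simp at hm; omega⟩
  let φ : (ZMod m → α) → {f : ZMod d → α // Function.IsPeriodicPt (rotateOne d) m f} :=
    fun g => ⟨fun x => g (ZMod.castHom hm (ZMod m) x),
      (isPeriodicPt_rotateOne_iff d m _).2 fun x => by rw [map_add, map_natCast]; simp⟩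
  have hφ : Function.Bijective φ := by
    constructor
    · intro g₁ g₂ h
      exact (ZMod.castHom_surjective hm).injective_comp_right (congrArg Subtype.val h)
    · rintro ⟨f, hf⟩
      rw [isPeriodicPt_rotateOne_iff] at hf
      refine ⟨fun y => f (y.val : ZMod d), Subtype.ext (funext fun x => ?_)⟩
      have hper : Function.Periodic (fun n : ℕ => f n) m := fun n => by
        simpa using hf n
      have hx := hper.map_mod_nat x.val
      simp only [ZMod.natCast_zmod_val] at hx
      have hval : (ZMod.castHom hm (ZMod m) x).val = x.val % m := by
        rw [← ZMod.val_natCast, ← map_natCast (ZMod.castHom hm (ZMod m)), ZMod.natCast_zmod_val]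
      simp only [φ]
      rw [hval, hx]
  rw [← Nat.card_eq_of_bijective φ hφ, Nat.card_fun, Nat.card_zmod]

theorem sum_moebius_divisors_filter_dvd_div {d p : ℕ} (hd : d ≠ 0) (hp : p ∣ d) :
    ∑ j ∈ d.divisors, (if p ∣ d / j then moebius j else 0) = if p = d then 1 else 0 := by
  obtain ⟨e, rfl⟩ := hp
  have hp0 : 0 < p := Nat.pos_of_ne_zero (left_ne_zero_of_mul hd)
  have he0 : e ≠ 0 := right_ne_zero_of_mul hd
  have hfilter : (p * e).divisors.filter (fun j => p ∣ p * e / j) = e.divisors := by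
    ext j
    simp only [Finset.mem_filter, Nat.mem_divisors]
    constructor
    · rintro ⟨⟨hj, -⟩, h⟩
      refine ⟨?_, he0⟩
      rw [Nat.dvd_div_iff_mul_dvd hj, mul_comm j p] at h
      exact Nat.dvd_of_mul_dvd_mul_left hp0 h
    · rintro ⟨hj, -⟩
      refine ⟨⟨hj.mul_left p, hd⟩, ?_⟩
      rw [Nat.dvd_div_iff_mul_dvd (hj.mul_left p), mul_comm j p]
      exact Nat.mul_dvd_mul_left p hj
  have hsum : ∑ j ∈ e.divisors, moebius j = if e = 1 then 1 else 0 := by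
    rw [← coe_mul_zeta_apply, moebius_mul_coe_zeta, one_apply]
  rw [← Finset.sum_filter, hfilter, hsum]
  simp [hp0.ne']

/-- Witt-formula counting: for `d ≥ 1`, the number of aperiodic functions
`ZMod d → Fin q` equals `∑_{j | d} μ(j) · q^{d/j}`. -/
theorem card_aperiodic_functions (d q : ℕ) (hd : 1 ≤ d) :
    (Nat.card {f : ZMod d → Fin q // Aperiodic d q f} : ℤ) =
      ∑ j ∈ d.divisors, (moebius j) * (q : ℤ) ^ (d / j) := by
  classical
  have : NeZero d := ⟨by omega⟩
  have hcard (P : (ZMod d → Fin q) → Prop) :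
      (Nat.card {f // P f} : ℤ) = ∑ f, if P f then 1 else 0 := by
    rw [Nat.card_eq_fintype_card, Fintype.card_subtype, Finset.sum_boole]
  have hterm : ∀ j ∈ d.divisors, moebius j * (q : ℤ) ^ (d / j) =
      ∑ f : ZMod d → Fin q,
        if Function.minimalPeriod (rotateOne d) f ∣ d / j then moebius j else 0 := by
    intro j hj
    have h := card_isPeriodicPt_rotateOne (α := Fin q) hd
      (Nat.div_dvd_of_dvd (Nat.dvd_of_mem_divisors hj))
    rw [Nat.card_eq_fintype_card (α := Fin q), Fintype.card_fin] at h
    rw [← Nat.cast_pow, ← h, hcard, Finset.mul_sum]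
    refine Finset.sum_congr rfl fun f _ => ?_
    simp [Function.isPeriodicPt_iff_minimalPeriod_dvd]
  rw [hcard, Finset.sum_congr rfl hterm, Finset.sum_comm]
  refine Finset.sum_congr rfl fun f _ => ?_
  rw [sum_moebius_divisors_filter_dvd_div (by omega) (minimalPeriod_rotateOne_dvd d f)]
  simp only [aperiodic_iff_minimalPeriod_eq hd]
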